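/- For any complex parameters α_0,…,α_5 with α_0+α_1+α_2+α_3+α_4+α_5 = 1, there is no rational solution (f_0,…,f_5) of A_5(α_0,…,α_5) such that for some i ∈ {0,…,5}, f_i, f_{i+1}, f_{i+2} have a pole at t=∞ and f_{i+3}, f_{i+4}, f_{i+5} are holomorphic at t=∞. -/

import Mathlib

open Filter Topology Polynomial

noncomputable section

/-- Evaluation of a complex rational function at a point (junk value where the
reduced denominator vanishes). -/
def evalR (f : RatFunc ℂ) (t : ℂ) : ℂ := RatFunc.eval (RingHom.id ℂ) t f

/-- `f` is defined at `t`: the reduced denominator does not vanish at `t`. -/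
def DefinedAt (f : RatFunc ℂ) (t : ℂ) : Prop := Polynomial.eval t (RatFunc.denom f) ≠ 0

/-- `(f 0, …, f 5)` is a rational solution of the `A₅⁽¹⁾` Painlevé system `A₅(α)`:
the two constraints hold identically as rational functions, and the six ODEs hold at
every point where all six components are defined.  (Indices are taken in `Fin 6`,
i.e. modulo `6`.) -/
def IsA5Solution (α : Fin 6 → ℂ) (f : Fin 6 → RatFunc ℂ) : Prop :=
  f 0 + f 2 + f 4 = RatFunc.X ∧
  f 1 + f 3 + f 5 = RatFunc.X ∧
  ∀ t : ℂ, (∀ j : Fin 6, DefinedAt (f j) t) → ∀ i : Fin 6,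
    t / 2 * deriv (evalR (f i)) t =
      evalR (f i) t *
        (evalR (f (i + 1)) t * evalR (f (i + 2)) t
          + evalR (f (i + 1)) t * evalR (f (i + 4)) t
          + evalR (f (i + 3)) t * evalR (f (i + 4)) t
          - evalR (f (i + 2)) t * evalR (f (i + 3)) t
          - evalR (f (i + 2)) t * evalR (f (i + 5)) t
          - evalR (f (i + 4)) t * evalR (f (i + 5)) t)
      + (1 / 2 - α (i + 2) - α (i + 4)) * evalR (f i) t
      + α i * (evalR (f (i + 2)) t + evalR (f (i + 4)) t)

/-- `f` has a pole at `t = ∞`: `‖f t‖ → ∞` as `‖t‖ → ∞`. -/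
def PoleAtInfty (f : RatFunc ℂ) : Prop :=
  Tendsto (fun t => ‖evalR f t‖) (Bornology.cobounded ℂ) atTop

/-- `f` is holomorphic at `t = ∞`: `f` is bounded as `‖t‖ → ∞`. -/
def HoloAtInfty (f : RatFunc ℂ) : Prop :=
  IsBoundedUnder (· ≤ ·) (Bornology.cobounded ℂ) fun t => ‖evalR f t‖

/-- `f` has a pole at `c ∈ ℂ`: `‖f t‖ → ∞` as `t → c`. -/
def PoleAt (f : RatFunc ℂ) (c : ℂ) : Prop :=
  Tendsto (fun t => ‖evalR f t‖) (𝓝[≠] c) atTop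

/-- `f` is regular at `c ∈ ℂ`: it extends continuously to `c`. -/
def RegularAt (f : RatFunc ℂ) (c : ℂ) : Prop :=
  ∃ L : ℂ, Tendsto (fun t => evalR f t) (𝓝[≠] c) (𝓝 L)

/-- `z` is an integer. -/
def IsInt (z : ℂ) : Prop := ∃ n : ℤ, z = (n : ℂ)

/-- `z` is an even integer. -/
def IsEvenInt (z : ℂ) : Prop := ∃ n : ℤ, z = 2 * (n : ℂ)

/-- A tuple of rational functions has pole configuration of Type A at `t = ∞`. -/
def TypeA (f : Fin 6 → RatFunc ℂ) : Prop :=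
  ∃ i : Fin 6,
    (PoleAtInfty (f i) ∧ PoleAtInfty (f (i + 1)) ∧ HoloAtInfty (f (i + 2)) ∧
      HoloAtInfty (f (i + 3)) ∧ HoloAtInfty (f (i + 4)) ∧ HoloAtInfty (f (i + 5))) ∨
    (PoleAtInfty (f i) ∧ PoleAtInfty (f (i + 3)) ∧ HoloAtInfty (f (i + 1)) ∧
      HoloAtInfty (f (i + 2)) ∧ HoloAtInfty (f (i + 4)) ∧ HoloAtInfty (f (i + 5))) ∨
    (PoleAtInfty (f i) ∧ PoleAtInfty (f (i + 1)) ∧ PoleAtInfty (f (i + 2)) ∧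
      PoleAtInfty (f (i + 4)) ∧ HoloAtInfty (f (i + 3)) ∧ HoloAtInfty (f (i + 5)))

/-- A tuple of rational functions has pole configuration of Type B at `t = ∞`. -/
def TypeB (f : Fin 6 → RatFunc ℂ) : Prop :=
  ∃ i : Fin 6,
    PoleAtInfty (f i) ∧ PoleAtInfty (f (i + 1)) ∧ PoleAtInfty (f (i + 2)) ∧
    PoleAtInfty (f (i + 3)) ∧ HoloAtInfty (f (i + 4)) ∧ HoloAtInfty (f (i + 5))


theorem tendsto_eval_div_eval_cobounded {p q : ℂ[X]} (hq : q ≠ 0)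
    (hpq : p.natDegree ≤ q.natDegree) :
    Tendsto (fun t => p.eval t / q.eval t) (Bornology.cobounded ℂ)
      (𝓝 (p.coeff q.natDegree / q.leadingCoeff)) := by
  have tendsto_normalized : ∀ {r : ℂ[X]}, r.natDegree ≤ q.natDegree →
      Tendsto (fun t => r.eval t / t ^ q.natDegree) (Bornology.cobounded ℂ)
        (𝓝 (r.coeff q.natDegree)) := by
    intro r hr
    have hinv : Tendsto (fun t : ℂ => (r.reflect q.natDegree).eval t⁻¹)
        (Bornology.cobounded ℂ) (𝓝 ((r.reflect q.natDegree).eval 0)) :=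
      ((r.reflect q.natDegree).continuous.tendsto 0).comp tendsto_inv₀_cobounded
    have hcoeff : (r.reflect q.natDegree).eval 0 = r.coeff q.natDegree := by
      rw [← coeff_zero_eq_eval_zero, coeff_reflect, revAt_le (Nat.zero_le _), Nat.sub_zero]
    rw [hcoeff] at hinv
    refine hinv.congr' ?_
    filter_upwards [Bornology.eventually_ne_cobounded (0 : ℂ)] with t ht
    rw [eq_div_iff (pow_ne_zero _ ht)]
    have : Invertible t := invertibleOfNonzero ht
    simpa using eval₂_reflect_mul_pow (RingHom.id ℂ) t q.natDegree r hr
  refine ((tendsto_normalized hpq).div (tendsto_normalized le_rfl)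
    (leadingCoeff_ne_zero.mpr hq)).congr' ?_
  filter_upwards [Bornology.eventually_ne_cobounded (0 : ℂ)] with t ht
  exact div_div_div_cancel_right₀ (pow_ne_zero _ ht) _ _

theorem eventually_eval_ne_zero {q : ℂ[X]} (hq : q ≠ 0) :
    ∀ᶠ t in Bornology.cobounded ℂ, q.eval t ≠ 0 := by
  have h : ∀ᶠ t in Bornology.cobounded ℂ, t ∉ {t | q.IsRoot t} :=
    (q.finite_setOfPred_isRoot hq).isBounded
  exact h

theorem eventually_definedAt (f : RatFunc ℂ) :
    ∀ᶠ t in Bornology.cobounded ℂ, DefinedAt f t :=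
  eventually_eval_ne_zero f.denom_ne_zero

theorem evalR_eq_div (f : RatFunc ℂ) (t : ℂ) :
    evalR f t = f.num.eval t / f.denom.eval t := by
  simp [evalR, RatFunc.eval, eval₂_id]

theorem evalR_add_add_eq_of_eq_X {f g h : RatFunc ℂ} (hX : f + g + h = RatFunc.X) {t : ℂ}
    (hf : DefinedAt f t) (hg : DefinedAt g t) (hh : DefinedAt h t) :
    evalR f t + evalR g t + evalR h t = t := by
  have hfg : DefinedAt (f + g) t := fun h0 => by
    have := eval_dvd (x := t) (RatFunc.denom_add_dvd f g)
    rw [h0, zero_dvd_iff, eval_mul] at this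
    exact mul_ne_zero hf hg this
  have hsum : evalR (f + g + h) t = evalR f t + evalR g t + evalR h t := by
    unfold evalR
    rw [RatFunc.eval_add _ _ (x := f + g) hfg hh, RatFunc.eval_add _ _ (x := f) hf hg]
  rw [← hsum, hX]
  simp [evalR]

theorem PoleAtInfty.not_isBigO_one {f : RatFunc ℂ} (hf : PoleAtInfty f) :
    ¬ evalR f =O[Bornology.cobounded ℂ] (fun _ => (1 : ℝ)) := fun h =>
  not_isBoundedUnder_of_tendsto_atTop hf ((Asymptotics.isBigO_one_iff ℝ).mp h)

theorem HoloAtInfty.isBigO_one {f : RatFunc ℂ} (hf : HoloAtInfty f) :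
    evalR f =O[Bornology.cobounded ℂ] (fun _ => (1 : ℝ)) :=
  (Asymptotics.isBigO_one_iff ℝ).mpr hf

theorem PoleAtInfty.natDegree_denom_lt {f : RatFunc ℂ} (hf : PoleAtInfty f) :
    f.denom.natDegree < f.num.natDegree := by
  by_contra! hle
  refine hf.not_isBigO_one ?_
  simpa only [← evalR_eq_div] using
    (tendsto_eval_div_eval_cobounded f.denom_ne_zero hle).isBigO_one ℝ

theorem PoleAtInfty.num_ne_zero {f : RatFunc ℂ} (hf : PoleAtInfty f) : f.num ≠ 0 := by
  intro h
  simpa [h] using hf.natDegree_denom_lt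

theorem PoleAtInfty.isBigO_id_div {f : RatFunc ℂ} (hf : PoleAtInfty f) :
    (fun t => t / evalR f t) =O[Bornology.cobounded ℂ] (fun _ => (1 : ℝ)) := by
  have hdeg : (X * f.denom).natDegree ≤ f.num.natDegree := by
    rw [natDegree_X_mul f.denom_ne_zero]
    exact hf.natDegree_denom_lt
  refine ((tendsto_eval_div_eval_cobounded hf.num_ne_zero hdeg).isBigO_one ℝ).congr_left ?_
  intro t
  rw [evalR_eq_div, eval_mul, eval_X, div_div_eq_mul_div]

theorem isBigO_mul_logDeriv_eval {p : ℂ[X]} (hp : p ≠ 0) :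
    (fun t => t * p.derivative.eval t / p.eval t) =O[Bornology.cobounded ℂ]
      (fun _ => (1 : ℝ)) := by
  have hdeg : (X * derivative p).natDegree ≤ p.natDegree := by
    by_cases h0 : p.natDegree = 0
    · rw [natDegree_eq_zero.mp h0 |>.choose_spec.symm]
      simp
    · have h1 := natDegree_derivative_le p
      have h2 := natDegree_mul_le (p := (X : ℂ[X])) (q := derivative p)
      rw [natDegree_X] at h2
      omega
  simpa using (tendsto_eval_div_eval_cobounded hp hdeg).isBigO_one ℝ

theorem deriv_evalR {f : RatFunc ℂ} {t : ℂ} (ht : DefinedAt f t) :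
    deriv (evalR f) t =
      (f.num.derivative.eval t * f.denom.eval t - f.num.eval t * f.denom.derivative.eval t) /
        f.denom.eval t ^ 2 := by
  rw [funext (evalR_eq_div f)]
  exact ((f.num.hasDerivAt t).div (f.denom.hasDerivAt t) ht).deriv

theorem isBigO_mul_logDeriv_evalR {f : RatFunc ℂ} (hf : f.num ≠ 0) :
    (fun t => t * deriv (evalR f) t / evalR f t) =O[Bornology.cobounded ℂ]
      (fun _ => (1 : ℝ)) := by
  refine ((isBigO_mul_logDeriv_eval hf).sub
    (isBigO_mul_logDeriv_eval f.denom_ne_zero)).congr' ?_ EventuallyEq.rfl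
  filter_upwards [eventually_eval_ne_zero hf, eventually_definedAt f] with t hnum hden
  have hden' : f.denom.eval t ≠ 0 := hden
  rw [deriv_evalR hden, evalR_eq_div]
  field_simp

theorem IsA5Solution.add_add_eq_X {α : Fin 6 → ℂ} {f : Fin 6 → RatFunc ℂ}
    (hf : IsA5Solution α f) (i : Fin 6) : f i + f (i + 2) + f (i + 4) = RatFunc.X := by
  obtain ⟨h0, h1, -⟩ := hf
  fin_cases i
  · exact h0
  · exact h1
  · exact (by ring : f 2 + f 4 + f 0 = f 0 + f 2 + f 4).trans h0
  · exact (by ring : f 3 + f 5 + f 1 = f 1 + f 3 + f 5).trans h1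
  · exact (by ring : f 4 + f 0 + f 2 = f 0 + f 2 + f 4).trans h0
  · exact (by ring : f 5 + f 1 + f 3 = f 1 + f 3 + f 5).trans h1

/-- Dividing the `i`-th equation by `f i` shows that its quadratic factor is bounded at infinity
if `f i` has a pole there; if also `f (i + 3)`, `f (i + 4)`, `f (i + 5)` are holomorphic there,
this quadratic factor is `t * (f (i + 2) + O(1))` up to a factor tending to `1`. -/
theorem IsA5Solution.isBigO_one_of_pole_of_holo {α : Fin 6 → ℂ} {f : Fin 6 → RatFunc ℂ}
    (hf : IsA5Solution α f) {i : Fin 6} (h0 : PoleAtInfty (f i)) (h3 : HoloAtInfty (f (i + 3)))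
    (h4 : HoloAtInfty (f (i + 4))) (h5 : HoloAtInfty (f (i + 5))) :
    evalR (f (i + 2)) =O[Bornology.cobounded ℂ] (fun _ => (1 : ℝ)) := by
  have hinv : Tendsto (fun t : ℂ => t⁻¹) (Bornology.cobounded ℂ) (𝓝 0) := tendsto_inv₀_cobounded
  have hinvO := hinv.isBigO_one ℝ
  have hconst (c : ℂ) : (fun _ : ℂ => c) =O[Bornology.cobounded ℂ] (fun _ => (1 : ℝ)) :=
    Asymptotics.isBigO_const_const _ one_ne_zero _
  have mulO {u v : ℂ → ℂ} (hu : u =O[Bornology.cobounded ℂ] (fun _ => (1 : ℝ)))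
      (hv : v =O[Bornology.cobounded ℂ] (fun _ => (1 : ℝ))) :
      (fun t => u t * v t) =O[Bornology.cobounded ℂ] (fun _ => (1 : ℝ)) := by
    simpa using hu.mul hv
  have hfactor : Tendsto
      (fun t => 1 - 2 * ((evalR (f (i + 3)) t + evalR (f (i + 5)) t) * t⁻¹))
      (Bornology.cobounded ℂ) (𝓝 1) := by
    have h : Tendsto (fun t => (evalR (f (i + 3)) t + evalR (f (i + 5)) t) * t⁻¹)
        (Bornology.cobounded ℂ) (𝓝 0) := by
      have := (h3.isBigO_one.add h5.isBigO_one).mul_isLittleO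
        ((Asymptotics.isLittleO_one_iff ℝ).mpr hinv)
      simp only [mul_one] at this
      exact (Asymptotics.isLittleO_one_iff ℝ).mp this
    simpa using (h.const_mul 2).const_sub 1
  have hquadO := (((hconst (1 / 2)).mul (isBigO_mul_logDeriv_evalR h0.num_ne_zero)).sub
    ((hconst (1 / 2 - α (i + 2) - α (i + 4))).mul (hconst 1))).sub
    ((hconst (α i)).mul (h0.isBigO_id_div.sub (hconst 1)))
  simp only [mul_one] at hquadO
  have hmain := mulO ((mulO hquadO hinvO).sub
    (mulO h4.isBigO_one ((hconst 1).sub (mulO (hconst 2) (mulO h5.isBigO_one hinvO)))))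
    ((hfactor.inv₀ one_ne_zero).isBigO_one ℝ)
  refine hmain.congr' ?_ EventuallyEq.rfl
  filter_upwards [eventually_all.mpr fun j => eventually_definedAt (f j),
    eventually_eval_ne_zero h0.num_ne_zero, Bornology.eventually_ne_cobounded (0 : ℂ),
    hfactor.eventually_ne one_ne_zero] with t hdef hnum ht hne
  have hode := hf.2.2 t hdef i
  have heven := evalR_add_add_eq_of_eq_X (hf.add_add_eq_X i) (hdef _) (hdef _) (hdef _)
  have hodd := evalR_add_add_eq_of_eq_X (hf.add_add_eq_X (i + 1)) (hdef _) (hdef _) (hdef _)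
  rw [add_assoc i 1 2, add_assoc i 1 4, show (1 + 2 : Fin 6) = 3 from rfl,
    show (1 + 4 : Fin 6) = 5 from rfl] at hodd
  have hfi : evalR (f i) t ≠ 0 := by
    rw [evalR_eq_div]
    exact div_ne_zero hnum (hdef i)
  rw [← div_eq_mul_inv, div_eq_iff hne]
  generalize evalR (f i) t = a0 at *
  generalize evalR (f (i + 1)) t = a1 at *
  generalize evalR (f (i + 2)) t = a2 at *
  generalize evalR (f (i + 3)) t = a3 at *
  generalize evalR (f (i + 4)) t = a4 at *
  generalize evalR (f (i + 5)) t = a5 at *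
  generalize deriv (evalR (f i)) t = d at *
  obtain rfl : a1 = t - a3 - a5 := by linear_combination hodd
  obtain rfl : a2 = t - a0 - a4 := by linear_combination heven
  field_simp
  linear_combination 2 * hode

/-- Nonexistence of rational solutions with the given pole configuration at `t = ∞`. -/
theorem stmt_4 (α : Fin 6 → ℂ)
    (hsum : α 0 + α 1 + α 2 + α 3 + α 4 + α 5 = 1) :
    ¬ ∃ (f : Fin 6 → RatFunc ℂ) (i : Fin 6), IsA5Solution α f ∧
      PoleAtInfty (f i) ∧
      PoleAtInfty (f (i + 1)) ∧
      PoleAtInfty (f (i + 2)) ∧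
      HoloAtInfty (f (i + 3)) ∧
      HoloAtInfty (f (i + 4)) ∧
      HoloAtInfty (f (i + 5)) := by
  rintro ⟨f, i, hf, h0, -, h2, h3, h4, h5⟩
  exact h2.not_isBigO_one (hf.isBigO_one_of_pole_of_holo h0 h3 h4 h5)
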